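/- arXiv:1705.00085 — 2 statements merged into one kernel-verified Lean document; each statement's English description precedes it below -/
import Mathlib

section
/- Let n > 2 be an odd natural number. Then for Lebesgue-almost every v ∈ ℂ^n, the family of 2n vectors {T^a v : a ∈ ℤ_n} ∪ {T^a D v : a ∈ ℤ_n} is a full spark frame: every subfamily of n of these 2n vectors is linearly independent. -/
/-- The `n × n` cyclic shift matrix `T`, acting by `(T v) j = v ((j - 1) mod n)`. -/
def shiftMat (n : ℕ) : Matrix (Fin n) (Fin n) ℂ :=
  Matrix.of fun j k => if ((k : ℕ) + 1) % n = (j : ℕ) then 1 else 0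

/-- The `n × n` reversal matrix `D`, acting by `(D v) j = v ((n - j) mod n)`. -/
def revMat (n : ℕ) : Matrix (Fin n) (Fin n) ℂ :=
  Matrix.of fun j k => if ((j : ℕ) + (k : ℕ)) % n = 0 then 1 else 0

/-- The family of `2n` vectors `{T^a v} ∪ {T^a D v}`, the `D₂ₙ`-orbit of `v`. -/
noncomputable def dihedralOrbit (n : ℕ) (v : Fin n → ℂ) :
    Fin 2 × Fin n → Fin n → ℂ :=
  fun p => ((shiftMat n) ^ (p.2 : ℕ)).mulVec (if p.1 = 0 then v else (revMat n).mulVec v)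

/-- A family of `2n` vectors in `ℂⁿ` is a full spark frame (has the Haar property)
if every subfamily of `n` of the vectors is linearly independent. -/
def IsFullSpark (n : ℕ) (f : Fin 2 × Fin n → Fin n → ℂ) : Prop :=
  ∀ S : Finset (Fin 2 × Fin n), S.card = n →
    LinearIndependent ℂ (fun i : {x // x ∈ S} => f i.1)

open MeasureTheory

open ZMod in
/-- Translation becomes modulation under the discrete Fourier transform. -/
theorem dft_comp_sub {N : ℕ} [NeZero N] (v : ZMod N → ℂ) (a k : ZMod N) :
    dft (fun j => v (j - a)) k = stdAddChar (-(a * k)) * dft v k := by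
  simp only [dft_apply, smul_eq_mul, Finset.mul_sum]
  refine Fintype.sum_equiv (Equiv.subRight a) _ _ fun j => ?_
  rw [Equiv.subRight_apply, ← mul_assoc, ← AddChar.map_add_eq_mul]
  congr 2
  ring

open ZMod in
/-- Reflection followed by translation, on the Fourier side. -/
theorem dft_comp_sub_left {N : ℕ} [NeZero N] (v : ZMod N → ℂ) (a k : ZMod N) :
    dft (fun j => v (a - j)) k = stdAddChar (-(a * k)) * dft v (-k) := by
  have h := dft_comp_sub (fun j => v (-j)) a k
  simp only [neg_sub] at h
  rw [h, dft_comp_neg]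

/-- A character sum supported on `A` that vanishes at `#A` consecutive frequencies is zero. -/
theorem eq_zero_of_sum_mul_stdAddChar_eq_zero {N : ℕ} [NeZero N] (A : Finset (ZMod N))
    (c : ZMod N → ℂ) (s : ℕ)
    (h : ∀ i < A.card, ∑ a ∈ A, c a * ZMod.stdAddChar (-(a * ((s + i : ℕ) : ZMod N))) = 0) :
    ∀ a ∈ A, c a = 0 := by
  have key := Matrix.eq_zero_of_forall_pow_sum_mul_pow_eq_zero
    (f := fun i => ZMod.stdAddChar (-((A.equivFin.symm i : A) : ZMod N)))
    (v := fun i => c (A.equivFin.symm i : A) *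
      ZMod.stdAddChar (-(((A.equivFin.symm i : A) : ZMod N) * (s : ZMod N))))
    (fun i j hij => by
      have := ZMod.injective_stdAddChar hij
      exact A.equivFin.symm.injective (Subtype.ext (neg_injective this)))
    (fun i => by
      rw [← h i i.2, ← Finset.sum_coe_sort A]
      refine Fintype.sum_equiv A.equivFin.symm _ _ fun j => ?_
      rw [← AddChar.map_nsmul_eq_pow, mul_assoc, ← AddChar.map_add_eq_mul]
      congr 2
      push_cast
      rw [nsmul_eq_mul]
      ring)
  intro a ha
  have h1 := congrFun key (A.equivFin ⟨a, ha⟩)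
  simp only [Equiv.symm_apply_apply, Pi.zero_apply, mul_eq_zero] at h1
  refine h1.resolve_right fun h0 => ?_
  have h2 := AddChar.map_add_eq_mul (ZMod.stdAddChar (N := N)) (-(a * s)) (a * s)
  rw [h0, zero_mul, neg_add_cancel, AddChar.map_zero_eq_one] at h2
  exact one_ne_zero h2

/-- A spectrum `w` that separates the translates in `A` from the reflected translates in `B`. -/
theorem exists_spectrum_of_two_mul_card_lt {N : ℕ} [NeZero N] (A B : Finset (ZMod N))
    (hAB : A.card + B.card = N) (hA : 2 * A.card < N) :
    ∃ w : ZMod N → ℂ, ∀ c d : ZMod N → ℂ,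
      (∀ k, w k * ∑ a ∈ A, c a * ZMod.stdAddChar (-(a * k)) +
        w (-k) * ∑ b ∈ B, d b * ZMod.stdAddChar (-(b * k)) = 0) →
      (∀ a ∈ A, c a = 0) ∧ ∀ b ∈ B, d b = 0 := by
  refine ⟨fun k => if 1 ≤ (-k).val ∧ (-k).val ≤ A.card then 0 else 1, fun c d h => ?_⟩
  simp only [neg_neg] at h
  have hc : ∀ a ∈ A, c a = 0 := by
    refine eq_zero_of_sum_mul_stdAddChar_eq_zero A c 1 fun i hi => ?_
    have hk := h ((1 + i : ℕ) : ZMod N)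
    have hv : ((1 + i : ℕ) : ZMod N).val = 1 + i := ZMod.val_natCast_of_lt (by omega)
    have hne : ((1 + i : ℕ) : ZMod N) ≠ 0 := by
      intro h0
      rw [h0, ZMod.val_zero] at hv
      omega
    have hneg : (-((1 + i : ℕ) : ZMod N)).val = N - (1 + i) := by
      rw [ZMod.neg_val, if_neg hne, hv]
    rw [hneg, hv, if_neg (by omega), if_pos (by omega)] at hk
    simpa using hk
  refine ⟨hc, eq_zero_of_sum_mul_stdAddChar_eq_zero B d (A.card + 1) fun i hi => ?_⟩
  have hk := h ((A.card + 1 + i : ℕ) : ZMod N)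
  have hv : ((A.card + 1 + i : ℕ) : ZMod N).val = (A.card + 1 + i) % N := ZMod.val_natCast _ _
  have hout : ¬ (1 ≤ (A.card + 1 + i) % N ∧ (A.card + 1 + i) % N ≤ A.card) := by
    rcases (show A.card + 1 + i ≤ N by omega).eq_or_lt with h0 | h0
    · simp [h0]
    · rw [Nat.mod_eq_of_lt h0]
      omega
  rw [hv, if_neg hout, Finset.sum_eq_zero (s := A) fun a ha => by rw [hc a ha, zero_mul]] at hk
  simpa using hk

/-- For odd `N`, no balance condition on `A` and `B` is needed. -/
theorem exists_spectrum_of_odd {N : ℕ} [NeZero N] (hodd : Odd N) (A B : Finset (ZMod N))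
    (hAB : A.card + B.card = N) :
    ∃ w : ZMod N → ℂ, ∀ c d : ZMod N → ℂ,
      (∀ k, w k * ∑ a ∈ A, c a * ZMod.stdAddChar (-(a * k)) +
        w (-k) * ∑ b ∈ B, d b * ZMod.stdAddChar (-(b * k)) = 0) →
      (∀ a ∈ A, c a = 0) ∧ ∀ b ∈ B, d b = 0 := by
  obtain ⟨r, hr⟩ := hodd
  rcases lt_or_ge (2 * A.card) N with h | h
  · exact exists_spectrum_of_two_mul_card_lt A B hAB h
  · obtain ⟨w, hw⟩ := exists_spectrum_of_two_mul_card_lt B A (by omega) (by omega)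
    refine ⟨fun k => w (-k), fun c d hcd => (hw d c fun k => ?_).symm⟩
    simpa only [neg_neg, add_comm] using hcd k

theorem shiftMat_mulVec (m : ℕ) (v : ZMod (m + 1) → ℂ) (j : ZMod (m + 1)) :
    (shiftMat (m + 1)).mulVec v j = v (j - 1) := by
  have key : ∀ k : ZMod (m + 1), (k.val + 1) % (m + 1) = j.val ↔ k = j - 1 := by
    intro k
    rw [eq_sub_iff_add_eq, ← (ZMod.val_injective (m + 1)).eq_iff, ZMod.val_add,
      ZMod.val_one_eq_one_mod, Nat.add_mod_mod]
  have h : (shiftMat (m + 1)).mulVec v j =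
      ∑ k : ZMod (m + 1), (if (k.val + 1) % (m + 1) = j.val then 1 else 0) * v k := rfl
  rw [h]
  simp [key]

theorem revMat_mulVec (m : ℕ) (v : ZMod (m + 1) → ℂ) (j : ZMod (m + 1)) :
    (revMat (m + 1)).mulVec v j = v (-j) := by
  have key : ∀ k : ZMod (m + 1), (j.val + k.val) % (m + 1) = 0 ↔ k = -j := by
    intro k
    rw [← ZMod.val_add, ZMod.val_eq_zero, eq_neg_iff_add_eq_zero, add_comm j k]
  have h : (revMat (m + 1)).mulVec v j =
      ∑ k : ZMod (m + 1), (if (j.val + k.val) % (m + 1) = 0 then 1 else 0) * v k := rfl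
  rw [h]
  simp [key]

theorem shiftMat_pow_mulVec (m k : ℕ) (v : ZMod (m + 1) → ℂ) (j : ZMod (m + 1)) :
    (shiftMat (m + 1) ^ k).mulVec v j = v (j - k) := by
  induction k generalizing j with
  | zero => exact (congrFun (Matrix.one_mulVec _) j).trans (by simp)
  | succ k ih =>
    have h : (shiftMat (m + 1) ^ (k + 1)).mulVec v =
        (shiftMat (m + 1)).mulVec ((shiftMat (m + 1) ^ k).mulVec v) := by
      rw [pow_succ']
      exact (Matrix.mulVec_mulVec _ _ _).symm
    refine (congrFun h j).trans ((shiftMat_mulVec m _ j).trans ((ih (j - 1)).trans ?_))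
    push_cast
    congr 1
    ring

/-- The `D₂ₙ`-orbit of a function on `ZMod N`, written in coordinates. -/
def dihedralTranslates {N : ℕ} (v : ZMod N → ℂ) (p : Fin 2 × ZMod N) (j : ZMod N) : ℂ :=
  if p.1 = 0 then v (j - p.2) else v (p.2 - j)

theorem dihedralOrbit_eq_dihedralTranslates (m : ℕ) (v : ZMod (m + 1) → ℂ) :
    dihedralOrbit (m + 1) v = dihedralTranslates v := by
  have h : ∀ (p : Fin 2 × ZMod (m + 1)) (j : ZMod (m + 1)),
      dihedralOrbit (m + 1) v p j = dihedralTranslates v p j := by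
    rintro ⟨e, a⟩ j
    refine (shiftMat_pow_mulVec m a.val _ j).trans ?_
    rw [ZMod.natCast_zmod_val]
    fin_cases e
    · rfl
    · refine (revMat_mulVec m v (j - a)).trans ?_
      rw [neg_sub]
      rfl
  exact funext fun p => funext fun j => h p j

theorem sum_eq_sum_filter_add_sum_filter {α M : Type*} [Fintype α] [DecidableEq α]
    [AddCommMonoid M] (S : Finset (Fin 2 × α)) (F : Fin 2 × α → M) :
    ∑ p ∈ S, F p = ∑ a with (0, a) ∈ S, F (0, a) + ∑ a with (1, a) ∈ S, F (1, a) := by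
  have h : ∑ p ∈ S, F p = ∑ p : Fin 2 × α, if p ∈ S then F p else 0 := by
    simp
  rw [h, Fintype.sum_prod_type, Fin.sum_univ_two, Finset.sum_filter, Finset.sum_filter]

theorem exists_linearIndepOn_dihedralTranslates {N : ℕ} [NeZero N] (hodd : Odd N)
    (S : Finset (Fin 2 × ZMod N)) (hS : S.card = N) :
    ∃ v : ZMod N → ℂ, LinearIndepOn ℂ (dihedralTranslates v) (S : Set (Fin 2 × ZMod N)) := by
  have hcard : (Finset.univ.filter fun a => ((0 : Fin 2), a) ∈ S).card +
      (Finset.univ.filter fun a => ((1 : Fin 2), a) ∈ S).card = N := by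
    refine Eq.trans ?_ hS
    rw [Finset.card_eq_sum_ones S, sum_eq_sum_filter_add_sum_filter]
    simp
  obtain ⟨w, hw⟩ := exists_spectrum_of_odd hodd _ _ hcard
  refine ⟨ZMod.dft.symm w, linearIndepOn_finset_iff.mpr fun g hg => ?_⟩
  rw [sum_eq_sum_filter_add_sum_filter] at hg
  have h0 : ∀ (v : ZMod N → ℂ) (a : ZMod N),
      dihedralTranslates v (0, a) = fun j => v (j - a) := fun _ _ => rfl
  have h1 : ∀ (v : ZMod N → ℂ) (a : ZMod N),
      dihedralTranslates v (1, a) = fun j => v (a - j) := fun _ _ => rfl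
  obtain ⟨hc, hd⟩ := hw (fun a => g (0, a)) (fun a => g (1, a)) fun k => by
    have hk := congrFun (congrArg ZMod.dft hg) k
    simp only [map_add, map_sum, map_smul, map_zero, Pi.add_apply, Finset.sum_apply,
      Pi.smul_apply, Pi.zero_apply, h0, h1, dft_comp_sub, dft_comp_sub_left,
      LinearEquiv.apply_symm_apply, smul_eq_mul] at hk
    rw [← hk, Finset.mul_sum, Finset.mul_sum]
    congr 1 <;> exact Finset.sum_congr rfl fun _ _ => by ring
  rintro ⟨e, a⟩ hp
  fin_cases e
  · exact hc a (by simpa using hp)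
  · exact hd a (by simpa using hp)

/-- Every `n`-element subfamily of the orbit is independent for at least one vector. -/
theorem exists_linearIndependent_dihedralOrbit {n : ℕ} (hodd : Odd n)
    (S : Finset (Fin 2 × Fin n)) (hS : S.card = n) :
    ∃ v : Fin n → ℂ,
      LinearIndependent ℂ (fun i : {x // x ∈ S} => dihedralOrbit n v i.1) := by
  obtain ⟨m, rfl⟩ : ∃ m, n = m + 1 := Nat.exists_eq_succ_of_ne_zero hodd.pos.ne'
  obtain ⟨v, hv⟩ := exists_linearIndepOn_dihedralTranslates (N := m + 1) hodd S hS
  rw [← dihedralOrbit_eq_dihedralTranslates] at hv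
  exact ⟨v, hv⟩

/-- A translate of a line in the direction of an invertible matrix meets the singular matrices
in finitely many points. -/
theorem finite_setOf_det_add_smul_eq_zero {K ι : Type*} [Field K] [Fintype ι] [DecidableEq ι]
    (A B : Matrix ι ι K) (hA : A.det ≠ 0) : {t : K | (B + t • A).det = 0}.Finite := by
  have hp : ((Polynomial.X : Polynomial K) • A.map Polynomial.C +
      B.map Polynomial.C).det ≠ 0 := by
    intro h
    apply hA
    rw [← Polynomial.coeff_det_X_add_C_card A B, h, Polynomial.coeff_zero]
  refine (Polynomial.finite_setOfPred_isRoot hp).subset fun t ht => ?_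
  rw [Set.mem_ofPred_eq] at ht ⊢
  rw [Polynomial.IsRoot, ← ht, ← Polynomial.coe_evalRingHom, RingHom.map_det]
  congr 1
  ext i j
  simp [add_comm (B i j), mul_comm t]

/-- If a linear family of square complex matrices contains an invertible one, almost all of its
members are invertible. -/
theorem ae_det_ne_zero_of_exists {E ι : Type*} [NormedAddCommGroup E] [NormedSpace ℂ E]
    [NormedSpace ℝ E] [IsScalarTower ℝ ℂ E]
    [FiniteDimensional ℂ E] [FiniteDimensional ℝ E] [MeasurableSpace E] [BorelSpace E]
    (μ : Measure E) [μ.IsAddHaarMeasure] [Fintype ι] [DecidableEq ι]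
    (M : E →ₗ[ℂ] Matrix ι ι ℂ) (h : ∃ v, (M v).det ≠ 0) : ∀ᵐ v ∂μ, (M v).det ≠ 0 := by
  obtain ⟨v₀, hv₀⟩ := h
  have hcont : Continuous fun v => (M v).det :=
    (show Continuous M from M.continuous_of_finiteDimensional).matrix_det
  have hmeas : MeasurableSet {v | (M v).det ≠ 0} :=
    (isOpen_ne_fun hcont continuous_const).measurableSet
  refine ae_mem_of_ae_add_linearMap_mem
    ((LinearMap.toSpanSingleton ℂ E v₀).restrictScalars ℝ) volume μ hmeas fun y => ?_
  have hfin := finite_setOf_det_add_smul_eq_zero (M v₀) (M y) hv₀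
  filter_upwards [compl_mem_ae_iff.mpr (hfin.measure_zero volume)] with t ht
  change (M (y + t • v₀)).det ≠ 0
  rwa [map_add, map_smul]

/-- The member of the orbit indexed by `p`, as a linear function of the vector. -/
noncomputable def dihedralOrbitLinear (n : ℕ) (p : Fin 2 × Fin n) :
    (Fin n → ℂ) →ₗ[ℂ] (Fin n → ℂ) :=
  (shiftMat n ^ (p.2 : ℕ)).mulVecLin ∘ₗ if p.1 = 0 then LinearMap.id else (revMat n).mulVecLin

theorem dihedralOrbitLinear_apply (n : ℕ) (p : Fin 2 × Fin n) (v : Fin n → ℂ) :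
    dihedralOrbitLinear n p v = dihedralOrbit n v p := by
  unfold dihedralOrbitLinear dihedralOrbit
  split_ifs <;> rfl

theorem ae_dihedral_orbit_full_spark_of_odd
    (n : ℕ) (hn : 2 < n) (hodd : Odd n) :
    ∀ᵐ v ∂(volume : Measure (Fin n → ℂ)), IsFullSpark n (dihedralOrbit n v) := by
  refine ae_all_iff.mpr fun S =>
    Filter.eventually_imp_distrib_left.mpr fun hS => ?_
  let e : Fin n ≃ {x // x ∈ S} := (S.equivFinOfCardEq hS).symm
  let M : (Fin n → ℂ) →ₗ[ℂ] Matrix (Fin n) (Fin n) ℂ :=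
    LinearMap.pi fun i => dihedralOrbitLinear n (e i)
  have hM : ∀ v, (M v).det ≠ 0 ↔
      LinearIndependent ℂ (fun i : {x // x ∈ S} => dihedralOrbit n v i.1) := by
    intro v
    rw [← isUnit_iff_ne_zero, ← Matrix.isUnit_iff_isUnit_det,
      ← Matrix.linearIndependent_rows_iff_isUnit, ← linearIndependent_equiv e]
    have h : (M v).row = (fun i : {x // x ∈ S} => dihedralOrbit n v i.1) ∘ e :=
      funext fun i => dihedralOrbitLinear_apply n (e i) v
    rw [h]
  obtain ⟨v, hv⟩ := exists_linearIndependent_dihedralOrbit hodd S hS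
  filter_upwards [ae_det_ne_zero_of_exists volume M ⟨v, (hM v).mpr hv⟩] with u hu
  exact (hM u).mp hu
end

section
/- Let n > 2 be an odd natural number. Then there exists a vector v ∈ ℂ^n such that the family of 2n vectors {T^a v : a ∈ ℤ_n} ∪ {T^a D v : a ∈ ℤ_n} is a full spark frame: every subfamily of n of these 2n vectors is linearly independent. -/
lemma shiftMat_mulVec_s6 {n : ℕ} {W : ℤ → ℂ} (hW : ∀ m, W (m + n) = W m) :
    (shiftMat n).mulVec (fun j : Fin n => W (j : ℕ)) = fun j : Fin n => W ((j : ℕ) - 1) := by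
  funext j
  have hj := j.isLt
  simp only [Matrix.mulVec, dotProduct, shiftMat, Matrix.of_apply, ite_mul, one_mul, zero_mul]
  by_cases h0 : (j : ℕ) = 0
  · rw [Finset.sum_eq_single (⟨n - 1, by omega⟩ : Fin n)]
    · rw [if_pos, ← hW ((j : ℕ) - 1)]
      · congr 1
        push_cast [h0, Nat.cast_sub (show 1 ≤ n by omega)]
        ring
      · simp [h0, Nat.sub_add_cancel (show 1 ≤ n by omega)]
    · intro k _ hk
      have hk' : (k : ℕ) ≠ n - 1 := fun h => hk (Fin.ext h)
      rw [if_neg]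
      rw [Nat.mod_eq_of_lt (by omega)]
      omega
    · simp
  · rw [Finset.sum_eq_single (⟨j - 1, by omega⟩ : Fin n)]
    · rw [if_pos]
      · congr 1
        push_cast [Nat.cast_sub (show 1 ≤ (j : ℕ) by omega)]
        ring
      · simp only
        rw [Nat.sub_add_cancel (by omega), Nat.mod_eq_of_lt hj]
    · intro k _ hk
      have hk' : (k : ℕ) ≠ j - 1 := fun h => hk (Fin.ext h)
      rw [if_neg]
      rcases Nat.lt_or_ge ((k : ℕ) + 1) n with h | h
      · rw [Nat.mod_eq_of_lt h]
        omega
      · rw [show (k : ℕ) + 1 = n by omega, Nat.mod_self]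
        omega
    · simp

lemma shiftMat_pow_mulVec_s6 {n : ℕ} {W : ℤ → ℂ} (hW : ∀ m, W (m + n) = W m) (a : ℕ) :
    (shiftMat n ^ a).mulVec (fun j : Fin n => W (j : ℕ)) = fun j : Fin n => W ((j : ℕ) - a) := by
  induction a with
  | zero => simp
  | succ a ih =>
    rw [pow_succ', ← Matrix.mulVec_mulVec, ih]
    rw [shiftMat_mulVec_s6 (W := fun m => W (m - a))]
    · funext j
      congr 1
      push_cast
      ring
    · intro m
      rw [← hW (m - a)]
      congr 1
      ring

lemma revMat_mulVec_s6 {n : ℕ} {W : ℤ → ℂ} (hW : ∀ m, W (m + n) = W m) :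
    (revMat n).mulVec (fun j : Fin n => W (j : ℕ)) = fun j : Fin n => W (-(j : ℕ)) := by
  funext j
  have hj := j.isLt
  simp only [Matrix.mulVec, dotProduct, revMat, Matrix.of_apply, ite_mul, one_mul, zero_mul]
  by_cases h0 : (j : ℕ) = 0
  · rw [Finset.sum_eq_single j]
    · simp [h0]
    · intro k _ hk
      have hk' : (k : ℕ) ≠ j := fun h => hk (Fin.ext h)
      rw [if_neg]
      rw [Nat.mod_eq_of_lt (by omega)]
      omega
    · simp
  · rw [Finset.sum_eq_single (⟨n - j, by omega⟩ : Fin n)]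
    · rw [if_pos, ← hW (-(j : ℕ))]
      · congr 1
        push_cast [Nat.cast_sub hj.le]
        ring
      · simp [Nat.add_sub_cancel' hj.le]
    · intro k _ hk
      have hk' : (k : ℕ) ≠ n - j := fun h => hk (Fin.ext h)
      rw [if_neg]
      intro h
      have := Nat.eq_of_dvd_of_lt_two_mul (by omega) (Nat.dvd_of_mod_eq_zero h) (by omega)
      omega
    · simp

/-- The trigonometric polynomial `∑ t ^ k ζ ^ (k m)` with frequencies `-h ≤ k ≤ h`. -/
noncomputable def geomTrigSum (h : ℕ) (ζ t : ℂ) (m : ℤ) : ℂ :=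
  ∑ i : Fin (2 * h + 1), t ^ ((i : ℤ) - h) * ζ ^ (((i : ℤ) - h) * m)

lemma geomTrigSum_add_period {h : ℕ} {ζ : ℂ} (hζ : IsPrimitiveRoot ζ (2 * h + 1)) (t : ℂ) (m : ℤ) :
    geomTrigSum h ζ t (m + (2 * h + 1 : ℕ)) = geomTrigSum h ζ t m := by
  have hζ0 : ζ ≠ 0 := hζ.ne_zero (by omega)
  refine Finset.sum_congr rfl fun i _ => ?_
  rw [mul_add, zpow_add₀ hζ0, mul_comm _ ((2 * h + 1 : ℕ) : ℤ),
    zpow_mul ζ ((2 * h + 1 : ℕ) : ℤ), zpow_natCast, hζ.pow_eq_one, one_zpow, mul_one]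

lemma geomTrigSum_neg (h : ℕ) (ζ t : ℂ) (m : ℤ) :
    geomTrigSum h ζ t (-m) = geomTrigSum h ζ t⁻¹ m := by
  refine Fintype.sum_equiv Fin.revPerm _ _ fun i => ?_
  have hi : ((Fin.revPerm i : Fin (2 * h + 1)) : ℤ) - h = -((i : ℤ) - h) := by
    have := i.isLt
    simp only [Fin.revPerm_apply, Fin.val_rev]
    omega
  rw [hi, inv_zpow', neg_neg]
  congr 2
  ring

lemma geomTrigSum_sub {h : ℕ} {ζ t : ℂ} (hζ : ζ ≠ 0) (ht : t ≠ 0) (j a : ℕ) :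
    geomTrigSum h ζ t (j - a) = ((t * (ζ ^ a)⁻¹) ^ h)⁻¹ *
      (∑ i : Fin (2 * h + 1), (t * (ζ ^ a)⁻¹) ^ (i : ℕ) * (ζ ^ j) ^ (i : ℕ)) * ((ζ ^ j) ^ h)⁻¹ := by
  have hx : t * (ζ ^ a)⁻¹ ≠ 0 := mul_ne_zero ht (inv_ne_zero (pow_ne_zero _ hζ))
  have hy : ζ ^ j ≠ 0 := pow_ne_zero _ hζ
  rw [Finset.mul_sum, Finset.sum_mul]
  refine Finset.sum_congr rfl fun i _ => ?_
  have key : t ^ ((i : ℤ) - h) * ζ ^ (((i : ℤ) - h) * (j - a)) =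
      (t * (ζ ^ a)⁻¹) ^ ((i : ℤ) - h) * (ζ ^ j) ^ ((i : ℤ) - h) := by
    rw [mul_zpow, mul_assoc, ← zpow_natCast ζ a, ← zpow_natCast ζ j, ← zpow_neg, ← zpow_mul,
      ← zpow_mul, ← zpow_add₀ hζ]
    congr 2
    ring
  rw [key, zpow_sub₀ hx, zpow_sub₀ hy]
  simp only [zpow_natCast]
  ring

lemma dihedralOrbit_geomTrigSum {h : ℕ} {ζ : ℂ} (hζ : IsPrimitiveRoot ζ (2 * h + 1)) (t : ℂ)
    (p : Fin 2 × Fin (2 * h + 1)) (j : Fin (2 * h + 1)) :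
    dihedralOrbit (2 * h + 1) (fun j => geomTrigSum h ζ t (j : ℕ)) p j =
      geomTrigSum h ζ (if p.1 = 0 then t else t⁻¹) ((j : ℕ) - (p.2 : ℕ)) := by
  unfold dihedralOrbit
  split_ifs
  · rw [shiftMat_pow_mulVec_s6 (geomTrigSum_add_period hζ t)]
  · rw [revMat_mulVec_s6 (geomTrigSum_add_period hζ t)]
    simp only [geomTrigSum_neg]
    rw [shiftMat_pow_mulVec_s6 (geomTrigSum_add_period hζ t⁻¹)]

lemma injective_orbit_nodes {n : ℕ} {ζ : ℂ} (hζ : IsPrimitiveRoot ζ n) :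
    Function.Injective fun p : Fin 2 × Fin n =>
      (if p.1 = 0 then 2 else 2⁻¹ : ℂ) * (ζ ^ (p.2 : ℕ))⁻¹ := by
  rintro ⟨e, a⟩ ⟨f, b⟩ hab
  have hn : n ≠ 0 := (Nat.zero_lt_of_lt a.isLt).ne'
  have hnorm := congrArg norm hab
  have hζ1 : ‖ζ‖ = 1 := hζ.norm'_eq_one hn
  simp only [norm_mul, norm_inv, norm_pow, hζ1, one_pow, inv_one, mul_one] at hnorm
  have hef : e = f := by
    fin_cases e <;> fin_cases f <;> first | rfl | (norm_num at hnorm)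
  subst hef
  have hc : (if e = 0 then 2 else 2⁻¹ : ℂ) ≠ 0 := by split_ifs <;> norm_num
  have := inv_injective (mul_left_cancel₀ hc hab)
  exact Prod.ext rfl (Fin.ext (hζ.pow_inj a.isLt b.isLt this))

theorem exists_vector_dihedral_orbit_full_spark
    (n : ℕ) (hn : 2 < n) (hodd : Odd n) :
    ∃ v : Fin n → ℂ, IsFullSpark n (dihedralOrbit n v) := by
  obtain ⟨h, rfl⟩ := hodd
  have hζ := Complex.isPrimitiveRoot_exp (2 * h + 1) (by omega)
  set ζ := Complex.exp (2 * Real.pi * Complex.I / (2 * h + 1 : ℕ))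
  have hζ0 : ζ ≠ 0 := hζ.ne_zero (by omega)
  refine ⟨fun j => geomTrigSum h ζ 2 (j : ℕ), fun S hS => ?_⟩
  let e := (S.equivFinOfCardEq hS).symm
  let c : Fin 2 × Fin (2 * h + 1) → ℂ := fun p => if p.1 = 0 then 2 else 2⁻¹
  have hc (p) : c p ≠ 0 := by
    simp only [c]
    split_ifs <;> norm_num
  let x : Fin (2 * h + 1) → ℂ := fun i => c (e i).1 * (ζ ^ ((e i).1.2 : ℕ))⁻¹
  let y : Fin (2 * h + 1) → ℂ := fun j => ζ ^ (j : ℕ)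
  have hx : Function.Injective x :=
    (injective_orbit_nodes hζ).comp (Subtype.val_injective.comp e.injective)
  have hy : Function.Injective y := fun i j hij => Fin.ext (hζ.pow_inj i.isLt j.isLt hij)
  have hM : (Matrix.of fun i => dihedralOrbit (2 * h + 1) (fun j => geomTrigSum h ζ 2 (j : ℕ)) (e i).1) =
      Matrix.diagonal (fun i => (x i ^ h)⁻¹) *
        (Matrix.vandermonde x * (Matrix.vandermonde y).transpose) *
        Matrix.diagonal (fun j => (y j ^ h)⁻¹) := by
    ext i j
    rw [Matrix.mul_diagonal, Matrix.diagonal_mul, Matrix.of_apply, dihedralOrbit_geomTrigSum hζ]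
    exact geomTrigSum_sub hζ0 (hc _) _ _
  rw [← linearIndependent_equiv e]
  refine Matrix.linearIndependent_rows_of_det_ne_zero (A := Matrix.of fun i =>
    dihedralOrbit (2 * h + 1) (fun j => geomTrigSum h ζ 2 (j : ℕ)) (e i).1) ?_
  rw [hM]
  simp only [Matrix.det_mul, Matrix.det_diagonal, Matrix.det_transpose]
  refine mul_ne_zero (mul_ne_zero ?_ (mul_ne_zero (Matrix.det_vandermonde_ne_zero_iff.2 hx)
    (Matrix.det_vandermonde_ne_zero_iff.2 hy))) ?_
  · exact Finset.prod_ne_zero_iff.2 fun i _ => inv_ne_zero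
      (pow_ne_zero _ (mul_ne_zero (hc _) (inv_ne_zero (pow_ne_zero _ hζ0))))
  · exact Finset.prod_ne_zero_iff.2 fun j _ => inv_ne_zero (pow_ne_zero _ (pow_ne_zero _ hζ0))
end
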